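/- arXiv:1711.05092 — 2 statements merged into one kernel-verified Lean document; each statement's English description precedes it below -/
import Mathlib

section
/- For the AV-rule with lexicographic tie-breaking, assume every voter has a full-rank set-extension, and let W be the set of the k highest-priority candidates of C under ▷. Then there exists a lazy-PNE A with outcome W_A = W if and only if W* ⊆ W. -/
open Finset

/-- The 0-indexed rank of candidate `c` within committee `W` with respect to the utility `u`:
the number of members of `W` strictly preferred to `c`.  Thus the most preferred member of `W`
has rank `0`. -/
noncomputable def owaRank {C : Type*} (u : C → ℝ) (W : Finset C) (c : C) : ℕ :=
  (W.filter fun c' => u c < u c').card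

/-- The OWA set-extension utility determined by the weights `lam` (where `lam 0` is the weight
`λ₁` put on the most preferred committee member, `lam 1` is `λ₂`, and so on) and the
utility function `u`. -/
noncomputable def owaUtil {C : Type*} (lam : ℕ → ℝ) (u : C → ℝ) (W : Finset C) : ℝ :=
  ∑ c ∈ W, lam (owaRank u W c) * u c

/-- The approval score of candidate `c` under the ballot profile `A`. -/
def score {N C : Type*} [Fintype N] [DecidableEq C] (A : N → Finset C) (c : C) : ℕ :=
  (Finset.univ.filter fun i => c ∈ A i).card

/-- Candidate `c` is ranked above candidate `c'` by the best-`k` scoring rule with scoring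
function `g`, with ties broken by the priority order: `c < c'` means `c` has higher
priority (`c ▷ c'`). -/
def beats {N C : Type*} [Fintype N] [DecidableEq C] [LT C]
    (g : C → ℕ → ℝ) (A : N → Finset C) (c c' : C) : Prop :=
  g c' (score A c') < g c (score A c) ∨
    (g c (score A c) = g c' (score A c') ∧ c < c')

open Classical in
/-- The winning committee: the `k` top-ranked candidates. -/
noncomputable def winners {N C : Type*} [Fintype N] [Fintype C] [DecidableEq C] [LT C]
    (g : C → ℕ → ℝ) (k : ℕ) (A : N → Finset C) : Finset C :=
  Finset.univ.filter fun c => (Finset.univ.filter fun c' => beats g A c' c).card < k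

/-- `B` is a best-response ballot of voter `i` against the other voters' ballots in `A`. -/
def BestResponse {N C : Type*} [Fintype N] [DecidableEq N] [Fintype C] [DecidableEq C] [LT C]
    (g : C → ℕ → ℝ) (k : ℕ) (lam : ℕ → ℝ) (u : C → ℝ)
    (A : N → Finset C) (i : N) (B : Finset C) : Prop :=
  ∀ B' : Finset C,
    owaUtil lam u (winners g k (Function.update A i B')) ≤
      owaUtil lam u (winners g k (Function.update A i B))

/-- `B` is a minimal best-response ballot of voter `i`. -/
def MinimalBestResponse {N C : Type*} [Fintype N] [DecidableEq N] [Fintype C] [DecidableEq C]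
    [LT C] (g : C → ℕ → ℝ) (k : ℕ) (lam : ℕ → ℝ) (u : C → ℝ)
    (A : N → Finset C) (i : N) (B : Finset C) : Prop :=
  BestResponse g k lam u A i B ∧
    ∀ B' : Finset C, BestResponse g k lam u A i B' → B.card ≤ B'.card

/-- A ballot profile is a lazy pure Nash equilibrium if every voter's ballot is a minimal
best response to the other voters' ballots. -/
def LazyPNE {N C : Type*} [Fintype N] [DecidableEq N] [Fintype C] [DecidableEq C] [LT C]
    (g : C → ℕ → ℝ) (k : ℕ) (lam : N → ℕ → ℝ) (u : N → C → ℝ) (A : N → Finset C) : Prop :=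
  ∀ i, MinimalBestResponse g k (lam i) (u i) A i (A i)

/-- A ballot is sincere if every approved candidate is preferred to every unapproved one. -/
def Sincere {C : Type*} (u : C → ℝ) (B : Finset C) : Prop :=
  ∀ c ∈ B, ∀ c' ∉ B, u c' < u c

section Ranking

variable {C α : Type*} [LinearOrder α]

/-- The number of members of `W` with a strictly larger key than `c`. -/
def keyRank (f : C → α) (W : Finset C) (c : C) : ℕ :=
  (W.filter fun c' => f c < f c').card

theorem keyRank_le_keyRank (f : C → α) (W : Finset C) {c c' : C} (h : f c ≤ f c') :
    keyRank f W c' ≤ keyRank f W c :=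
  card_le_card fun _ hx => by
    rw [mem_filter] at hx ⊢
    exact ⟨hx.1, h.trans_lt hx.2⟩

theorem keyRank_lt_keyRank (f : C → α) {W : Finset C} {c c' : C} (hc' : c' ∈ W)
    (h : f c < f c') : keyRank f W c' < keyRank f W c := by
  refine card_lt_card ((ssubset_iff_of_subset fun x hx => ?_).2 ⟨c', ?_, ?_⟩)
  · rw [mem_filter] at hx ⊢
    exact ⟨hx.1, h.trans hx.2⟩
  · simp [hc', h]
  · simp

theorem keyRank_lt_card (f : C → α) {W : Finset C} {c : C} (hc : c ∈ W) :
    keyRank f W c < W.card :=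
  card_lt_card (filter_ssubset.2 ⟨c, hc, lt_irrefl _⟩)

theorem injOn_keyRank {f : C → α} (hf : Function.Injective f) (W : Finset C) :
    Set.InjOn (keyRank f W) W := by
  intro c hc c' hc' h
  by_contra hne
  rcases lt_or_gt_of_ne (hf.ne hne) with hlt | hlt
  · exact (keyRank_lt_keyRank f hc' hlt).ne' h
  · exact (keyRank_lt_keyRank f hc hlt).ne h

theorem image_keyRank {f : C → α} (hf : Function.Injective f) (W : Finset C) :
    W.image (keyRank f W) = range W.card := by
  refine eq_of_subset_of_card_le (fun n hn => ?_) ?_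
  · obtain ⟨c, hc, rfl⟩ := mem_image.1 hn
    exact mem_range.2 (keyRank_lt_card f hc)
  · rw [card_range, card_image_of_injOn (injOn_keyRank hf W)]

theorem card_filter_keyRank_lt {f : C → α} (hf : Function.Injective f) (W : Finset C) {k : ℕ}
    (hk : k ≤ W.card) : (W.filter fun c => keyRank f W c < k).card = k := by
  rw [← card_image_of_injOn ((injOn_keyRank hf W).mono (filter_subset _ W)),
    ← filter_image (p := fun n => n < k), image_keyRank hf]
  have : (range W.card).filter (fun n => n < k) = range k := by
    ext n
    simp only [mem_filter, mem_range]
    omega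
  rw [this, card_range]

end Ranking

section Utility

variable {C : Type*} {u : C → ℝ}

/-- Committees of equal size are related by the bijection matching their members by rank. -/
theorem exists_rank_matching (hu : Function.Injective u) {V W : Finset C}
    (hVW : V.card = W.card) (lam : ℕ → ℝ) :
    ∃ e : C → C, (∀ c ∈ V, e c ∈ W ∧ owaRank u W (e c) = owaRank u V c) ∧
      owaUtil lam u W = ∑ c ∈ V, lam (owaRank u V c) * u (e c) := by
  have hex : ∀ c, ∃ d, c ∈ V → d ∈ W ∧ owaRank u W d = owaRank u V c := by
    intro c
    by_cases hc : c ∈ V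
    · have h : owaRank u V c ∈ W.image (keyRank u W) := by
        rw [image_keyRank hu, ← hVW]
        exact mem_range.2 (keyRank_lt_card u hc)
      obtain ⟨d, hd, hdc⟩ := mem_image.1 h
      exact ⟨d, fun _ => ⟨hd, hdc⟩⟩
    · exact ⟨c, fun h => absurd h hc⟩
  choose e he using hex
  have hinj : Set.InjOn e V := fun c hc c' hc' h =>
    injOn_keyRank hu V hc hc' ((he c hc).2.symm.trans (h ▸ (he c' hc').2))
  refine ⟨e, he, (sum_nbij e (fun c hc => (he c hc).1) hinj ?_ fun c hc => ?_).symm⟩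
  · exact surjOn_of_injOn_of_card_le e (fun c hc => (he c hc).1) hinj hVW.ge
  · rw [(he c hc).2]

variable {S V W : Finset C}

theorem mem_of_lt_of_top (htop : ∀ c ∈ S, ∀ c' ∉ S, u c' < u c) {c x : C} (hc : c ∈ S)
    (h : u c < u x) : x ∈ S := by
  by_contra hx
  exact lt_asymm h (htop c hc x hx)

theorem le_of_owaRank_eq (htop : ∀ c ∈ S, ∀ c' ∉ S, u c' < u c) (hSV : S ⊆ V) {c d : C}
    (hc : c ∈ S) (h : owaRank u W d = owaRank u V c) : u d ≤ u c := by
  by_contra! hlt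
  have hd' : d ∈ V := hSV (mem_of_lt_of_top htop hc hlt)
  refine h.not_lt (card_lt_card ((ssubset_iff_of_subset fun x hx => ?_).2
    ⟨d, mem_filter.2 ⟨hd', hlt⟩, by simp⟩))
  have hx := hlt.trans (mem_filter.1 hx).2
  exact mem_filter.2 ⟨hSV (mem_of_lt_of_top htop hc hx), hx⟩

theorem owaRank_lt_card_of_top (htop : ∀ c ∈ S, ∀ c' ∉ S, u c' < u c) {c : C} (hc : c ∈ S) :
    owaRank u V c < S.card :=
  card_lt_card ((ssubset_iff_of_subset fun _ hx =>
    mem_of_lt_of_top htop hc (mem_filter.1 hx).2).2 ⟨c, hc, by simp⟩)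

theorem card_le_owaRank_of_top (htop : ∀ c ∈ S, ∀ c' ∉ S, u c' < u c) (hSV : S ⊆ V) {c : C}
    (hc : c ∉ S) : S.card ≤ owaRank u V c :=
  card_le_card fun x hx => mem_filter.2 ⟨hSV hx, htop x hx c hc⟩

theorem weighted_le_weighted {lam : ℕ → ℝ} (hlam : ∀ n, 0 ≤ lam n)
    (hz : ∀ n, S.card ≤ n → lam n = 0) (htop : ∀ c ∈ S, ∀ c' ∉ S, u c' < u c) (hSV : S ⊆ V)
    {c d : C} (h : owaRank u W d = owaRank u V c) :
    lam (owaRank u V c) * u d ≤ lam (owaRank u V c) * u c := by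
  by_cases hc : c ∈ S
  · exact mul_le_mul_of_nonneg_left (le_of_owaRank_eq htop hSV hc h) (hlam _)
  · simp [hz _ (card_le_owaRank_of_top htop hSV hc)]

theorem owaUtil_le_of_top_subset (hu : Function.Injective u) (hVW : V.card = W.card)
    {lam : ℕ → ℝ} (hlam : ∀ n, 0 ≤ lam n) (hz : ∀ n, S.card ≤ n → lam n = 0)
    (htop : ∀ c ∈ S, ∀ c' ∉ S, u c' < u c) (hSV : S ⊆ V) :
    owaUtil lam u W ≤ owaUtil lam u V := by
  obtain ⟨e, he, hW⟩ := exists_rank_matching hu hVW lam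
  rw [hW]
  exact sum_le_sum fun c hc => weighted_le_weighted hlam hz htop hSV (he c hc).2

theorem owaUtil_lt_of_top_not_subset (hu : Function.Injective u) (hVW : V.card = W.card)
    {lam : ℕ → ℝ} (hlam : ∀ n, 0 ≤ lam n) (hz : ∀ n, S.card ≤ n → lam n = 0)
    (hfull : ∀ n, n < S.card → 0 < lam n)
    (htop : ∀ c ∈ S, ∀ c' ∉ S, u c' < u c) (hSV : S ⊆ V) (hSW : ¬ S ⊆ W) :
    owaUtil lam u W < owaUtil lam u V := by
  obtain ⟨e, he, hW⟩ := exists_rank_matching hu hVW lam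
  obtain ⟨c, hcS, hcW⟩ := not_subset.1 hSW
  rw [hW]
  refine sum_lt_sum (fun c hc => weighted_le_weighted hlam hz htop hSV (he c hc).2)
    ⟨c, hSV hcS, mul_lt_mul_of_pos_left ?_ (hfull _ (owaRank_lt_card_of_top htop hcS))⟩
  have hc := he c (hSV hcS)
  refine (le_of_owaRank_eq htop hSV hcS hc.2).lt_of_ne fun h => hcW ?_
  exact hu h ▸ hc.1

end Utility

section Approval

variable {N C : Type*} [Fintype N] [LinearOrder C]

/-- The lexicographic key by which the AV-rule orders candidates. -/
def avKey (A : N → Finset C) (c : C) : ℕ ×ₗ Cᵒᵈ :=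
  toLex (score A c, OrderDual.toDual c)

theorem avKey_injective (A : N → Finset C) : Function.Injective (avKey A) := fun _ _ h =>
  OrderDual.toDual.injective (congrArg Prod.snd (toLex.injective h))

theorem avKey_lt_iff (A A' : N → Finset C) (c c' : C) :
    avKey A c' < avKey A' c ↔ score A c' < score A' c ∨ score A c' = score A' c ∧ c < c' := by
  simp [avKey, Prod.Lex.toLex_lt_toLex]

theorem avKey_le_avKey {A A' : N → Finset C} {c : C} (h : score A c ≤ score A' c) :
    avKey A c ≤ avKey A' c := by
  rw [avKey, avKey, Prod.Lex.toLex_le_toLex]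
  exact h.lt_or_eq.imp_right fun h => ⟨h, le_rfl⟩

theorem beats_iff_avKey_lt (A : N → Finset C) (c c' : C) :
    beats (fun _ n => (n : ℝ)) A c c' ↔ avKey A c' < avKey A c := by
  rw [avKey_lt_iff, beats, Nat.cast_lt, Nat.cast_inj, eq_comm (a := score A c)]

theorem score_eq_zero {A : N → Finset C} {c : C} (h : ∀ j, c ∉ A j) : score A c = 0 := by
  simp [score, h]

variable [Fintype C] {k : ℕ}

theorem winners_eq_filter (A : N → Finset C) :
    winners (fun _ n => (n : ℝ)) k A = univ.filter fun c => keyRank (avKey A) univ c < k := by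
  ext c
  rw [winners, mem_filter, mem_filter, keyRank]
  simp only [beats_iff_avKey_lt]

theorem card_winners (hk : k ≤ Fintype.card C) (A : N → Finset C) :
    (winners (fun _ n => (n : ℝ)) k A).card = k := by
  rw [winners_eq_filter]
  exact card_filter_keyRank_lt (avKey_injective A) univ hk

theorem avKey_lt_of_winner {A : N → Finset C} {c c' : C}
    (hc : c ∈ winners (fun _ n => (n : ℝ)) k A) (hc' : c' ∉ winners (fun _ n => (n : ℝ)) k A) :
    avKey A c' < avKey A c := by
  simp only [winners_eq_filter, mem_filter, mem_univ, true_and, not_lt] at hc hc'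
  by_contra! h
  exact (hc'.trans (keyRank_le_keyRank _ univ h)).not_gt hc

theorem subset_winners {A : N → Finset C} {S : Finset C} (hS : S.card ≤ k)
    (h : ∀ c ∈ S, ∀ c' ∉ S, avKey A c' < avKey A c) :
    S ⊆ winners (fun _ n => (n : ℝ)) k A := by
  intro c hc
  rw [winners_eq_filter, mem_filter]
  refine ⟨mem_univ c, lt_of_lt_of_le (card_lt_card ((ssubset_iff_of_subset ?_).2
    ⟨c, hc, by simp⟩)) hS⟩
  intro x hx
  by_contra hxS
  exact lt_asymm (mem_filter.1 hx).2 (h c hc x hxS)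

theorem winners_eq (hk : k ≤ Fintype.card C) {A : N → Finset C} {S : Finset C} (hS : S.card = k)
    (h : ∀ c ∈ S, ∀ c' ∉ S, avKey A c' < avKey A c) :
    winners (fun _ n => (n : ℝ)) k A = S :=
  (eq_of_subset_of_card_le (subset_winners hS.le h) (by rw [card_winners hk, hS])).symm

theorem winners_eq_of_ballots_subset (hk : k ≤ Fintype.card C) {A : N → Finset C} {T : Finset C}
    (hT : T.card = k) (hTtop : ∀ c ∈ T, ∀ c' ∉ T, c < c') (hA : ∀ j, A j ⊆ T) :
    winners (fun _ n => (n : ℝ)) k A = T := by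
  refine winners_eq hk hT fun c hc c' hc' => (avKey_lt_iff _ _ _ _).2 ?_
  rw [score_eq_zero fun j hj => hc' (hA j hj)]
  exact (Nat.eq_zero_or_pos (score A c)).symm.imp_right fun h => ⟨h.symm, hTtop c hc c' hc'⟩

variable [DecidableEq N]

theorem winners_update_erase (hk : k ≤ Fintype.card C) (A : N → Finset C) (i : N) {c : C}
    (hc : c ∉ winners (fun _ n => (n : ℝ)) k A) :
    winners (fun _ n => (n : ℝ)) k (Function.update A i ((A i).erase c)) =
      winners (fun _ n => (n : ℝ)) k A := by
  have hmem : ∀ j x, x ∈ Function.update A i ((A i).erase c) j → x ∈ A j := by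
    intro j x hx
    rcases eq_or_ne j i with rfl | hj
    · rw [Function.update_self] at hx
      exact mem_of_mem_erase hx
    · rwa [Function.update_of_ne hj] at hx
  have hmem' : ∀ j x, x ≠ c → x ∈ A j → x ∈ Function.update A i ((A i).erase c) j := by
    intro j x hxc hx
    rcases eq_or_ne j i with rfl | hj
    · rw [Function.update_self]
      exact mem_erase.2 ⟨hxc, hx⟩
    · rwa [Function.update_of_ne hj]
  refine winners_eq hk (card_winners hk A) fun d hd d' hd' => ?_
  calc avKey (Function.update A i ((A i).erase c)) d' ≤ avKey A d' :=
        avKey_le_avKey (card_le_card (monotone_filter_right _ fun j _ => hmem j d'))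
    _ < avKey A d := avKey_lt_of_winner hd hd'
    _ ≤ avKey (Function.update A i ((A i).erase c)) d :=
        avKey_le_avKey (card_le_card (monotone_filter_right _ fun j _ =>
          hmem' j d (ne_of_mem_of_not_mem hd hc)))

theorem MinimalBestResponse.card_le_of_winners_eq {g : C → ℕ → ℝ} {lam : ℕ → ℝ} {u : C → ℝ}
    {A : N → Finset C} {i : N} {B : Finset C} (h : MinimalBestResponse g k lam u A i (A i))
    (hB : winners g k (Function.update A i B) = winners g k A) : (A i).card ≤ B.card := by
  refine h.2 B fun B' => ?_
  have := h.1 B'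
  rwa [Function.update_eq_self, ← hB] at this

theorem LazyPNE.ballot_subset_winners (hk : k ≤ Fintype.card C) {lam : N → ℕ → ℝ}
    {u : N → C → ℝ} {A : N → Finset C} (hA : LazyPNE (fun _ n => (n : ℝ)) k lam u A) (i : N) :
    A i ⊆ winners (fun _ n => (n : ℝ)) k A := by
  intro c hc
  by_contra hcW
  exact ((hA i).card_le_of_winners_eq (winners_update_erase hk A i hcW)).not_gt
    (card_erase_lt_of_mem hc)

/-- If the outcome of a lazy-PNE is the set of highest-priority candidates, then every
ballot is empty. -/
theorem LazyPNE.ballot_eq_empty (hk : k ≤ Fintype.card C) {lam : N → ℕ → ℝ}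
    {u : N → C → ℝ} {A : N → Finset C} (hA : LazyPNE (fun _ n => (n : ℝ)) k lam u A)
    {T : Finset C} (hT : T.card = k) (hTtop : ∀ c ∈ T, ∀ c' ∉ T, c < c')
    (hAT : winners (fun _ n => (n : ℝ)) k A = T) (i : N) : A i = ∅ := by
  have hsub : ∀ j, Function.update A i ∅ j ⊆ T := by
    intro j
    rcases eq_or_ne j i with rfl | hj
    · simp
    · rw [Function.update_of_ne hj, ← hAT]
      exact hA.ballot_subset_winners hk j
  have h := (hA i).card_le_of_winners_eq
    ((winners_eq_of_ballots_subset hk hT hTtop hsub).trans hAT.symm)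
  simpa using h

theorem subset_winners_update {A : N → Finset C} (hA : ∀ j, A j = ∅) (i : N) {S : Finset C}
    (hS : S.card ≤ k) : S ⊆ winners (fun _ n => (n : ℝ)) k (Function.update A i S) := by
  refine subset_winners hS fun c hc c' hc' => (avKey_lt_iff _ _ _ _).2 (Or.inl ?_)
  rw [score_eq_zero fun j => ?_]
  · exact card_pos.2 ⟨i, by simpa using hc⟩
  · rcases eq_or_ne j i with rfl | hj
    · simpa using hc'
    · simp [Function.update_of_ne hj, hA]

end Approval

/-- under the full-rank assumption, the set `T` of the `k` highest-priority
candidates is a lazy-PNE outcome iff `W* ⊆ T`. -/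
theorem statement_15 {N C : Type*} [Fintype N] [DecidableEq N] [Fintype C] [LinearOrder C]
    (k : ℕ) (hk1 : 1 ≤ k) (hk2 : k ≤ Fintype.card C)
    (u : N → C → ℝ) (hu : ∀ i, Function.Injective (u i))
    (lam : N → ℕ → ℝ) (hlam : ∀ i n, 0 ≤ lam i n)
    (jstar : N → ℕ) (hj1 : ∀ i, 1 ≤ jstar i) (hjk : ∀ i, jstar i ≤ k)
    (hz : ∀ i n, jstar i ≤ n → lam i n = 0)
    (hfull : ∀ i n, n < jstar i → 0 < lam i n)
    (Wst : N → Finset C) (hWstcard : ∀ i, (Wst i).card = jstar i)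
    (hWsttop : ∀ i, ∀ c ∈ Wst i, ∀ c' ∉ Wst i, u i c' < u i c)
    (T : Finset C) (hTcard : T.card = k) (hTtop : ∀ c ∈ T, ∀ c' ∉ T, c < c') :
    (∃ A : N → Finset C, LazyPNE (fun _ n => (n : ℝ)) k lam u A ∧
        winners (fun _ n => (n : ℝ)) k A = T) ↔
      Finset.univ.biUnion Wst ⊆ T := by
  constructor
  · rintro ⟨A, hA, hAT⟩
    refine biUnion_subset.2 fun i _ => ?_
    by_contra hsub
    have hV := subset_winners_update (hA.ballot_eq_empty hk2 hTcard hTtop hAT) i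
      ((hWstcard i).trans_le (hjk i))
    have hBR := (hA i).1 (Wst i)
    rw [Function.update_eq_self, hAT] at hBR
    refine hBR.not_gt (owaUtil_lt_of_top_not_subset (hu i) ?_ (hlam i) ?_ ?_ (hWsttop i) hV hsub)
    · rw [card_winners hk2, hTcard]
    · exact fun n hn => hz i n (hWstcard i ▸ hn)
    · exact fun n hn => hfull i n (hWstcard i ▸ hn)
  · intro hsub
    have hw : winners (fun _ n => (n : ℝ)) k (fun _ : N => (∅ : Finset C)) = T :=
      winners_eq_of_ballots_subset hk2 hTcard hTtop fun _ => empty_subset T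
    refine ⟨fun _ => ∅, fun i => ⟨fun B' => ?_, fun B' _ => by simp⟩, hw⟩
    rw [Function.update_eq_self (f := fun _ : N => (∅ : Finset C)) (a := i), hw]
    refine owaUtil_le_of_top_subset (hu i) ?_ (hlam i) ?_ (hWsttop i)
      (biUnion_subset.1 hsub i (mem_univ i))
    · rw [card_winners hk2, hTcard]
    · exact fun n hn => hz i n (hWstcard i ▸ hn)
end

section
/- For the AV-rule with lexicographic tie-breaking and committee size k = 1, label C = {c_1, …, c_m} so that c_1 ▷ c_2 ▷ ⋯ ▷ c_m. For any index j, there exists a lazy-PNE A with outcome W_A = {c_j} if and only if either (i) c_j is every voter's most preferred candidate in C, or (ii) j > 1, c_j is some voter's most preferred candidate in C, and u_i(c_j) > u_i(c_ℓ) for every voter i ∈ N and every ℓ < j. -/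
open Finset

/-- Candidate `c` wins the single-winner approval vote with ties broken by priority. -/
def IsWinner {N C : Type*} [Fintype N] [LinearOrder C] (A : N → Finset C) (c : C) : Prop :=
  ∀ c', score A c' < score A c ∨ (score A c' = score A c ∧ c ≤ c')

lemma owaUtil_singleton {C : Type*} (lam : ℕ → ℝ) (v : C → ℝ) (c : C) :
    owaUtil lam v {c} = lam 0 * v c := by
  simp [owaUtil, owaRank, filter_singleton]

section SingleWinner

variable {N C : Type*} [Fintype N] [LinearOrder C]

lemma IsWinner.eq {A : N → Finset C} {c d : C} (hc : IsWinner A c) (hd : IsWinner A d) :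
    c = d := by
  rcases hc d with h | ⟨h, h₁⟩ <;> rcases hd c with h' | ⟨h', h₂⟩
  · omega
  · omega
  · omega
  · exact le_antisymm h₁ h₂

lemma exists_isWinner [Fintype C] [Nonempty C] (A : N → Finset C) : ∃ c, IsWinner A c := by
  obtain ⟨c, hc⟩ := Finite.exists_max fun c => toLex (score A c, OrderDual.toDual c)
  refine ⟨c, fun d => ?_⟩
  simpa [Prod.Lex.le_iff] using hc d

lemma mem_winners_iff [Fintype C] (A : N → Finset C) (c : C) :
    c ∈ winners (fun _ n => (n : ℝ)) 1 A ↔ IsWinner A c := by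
  simp only [winners, mem_filter, mem_univ, true_and, Nat.lt_one_iff, card_eq_zero,
    filter_eq_empty_iff, beats, IsWinner, Nat.cast_lt, Nat.cast_inj, forall_true_left]
  refine forall_congr' fun d => ?_
  rw [← not_lt (a := d)]
  by_cases h : d < c <;> simp only [h, and_true, and_false, or_false, not_true, not_false_iff] <;>
    omega

lemma winners_eq_singleton_iff [Fintype C] (A : N → Finset C) (c : C) :
    winners (fun _ n => (n : ℝ)) 1 A = {c} ↔ IsWinner A c := by
  constructor
  · intro h
    rw [← mem_winners_iff, h]
    exact mem_singleton_self c
  · intro h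
    ext d
    rw [mem_winners_iff, mem_singleton]
    exact ⟨fun hd => hd.eq h, fun hd => hd ▸ h⟩

variable [DecidableEq N]

lemma score_update (A : N → Finset C) (i : N) (B : Finset C) (c : C) :
    score (Function.update A i B) c =
      score (Function.update A i ∅) c + if c ∈ B then 1 else 0 := by
  simp only [score, card_filter]
  rw [Fintype.sum_eq_add_sum_compl i, Fintype.sum_eq_add_sum_compl (a := i) (fun _ => ite _ _ _)]
  have h : ∀ k ∈ ({i} : Finset N)ᶜ, (if c ∈ Function.update A i B k then 1 else 0) =
      if c ∈ Function.update A i ∅ k then 1 else 0 := by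
    intro k hk
    have hk' : k ≠ i := by simpa using hk
    simp [hk']
  rw [sum_congr rfl h]
  simp [add_comm]

lemma score_eq_add (A : N → Finset C) (i : N) (c : C) :
    score A c = score (Function.update A i ∅) c + if c ∈ A i then 1 else 0 := by
  rw [← score_update, Function.update_eq_self]

lemma bestResponse_iff [Fintype C] [Nonempty C] {lam : ℕ → ℝ} (hlam : 0 < lam 0) {v : C → ℝ}
    {A : N → Finset C} {i : N} {B : Finset C} {c : C}
    (hc : IsWinner (Function.update A i B) c) :
    BestResponse (fun _ n => (n : ℝ)) 1 lam v A i B ↔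
      ∀ B' d, IsWinner (Function.update A i B') d → v d ≤ v c := by
  unfold BestResponse
  refine forall_congr' fun B' => ?_
  rw [(winners_eq_singleton_iff _ _).2 hc, owaUtil_singleton]
  constructor
  · intro h d hd
    rw [(winners_eq_singleton_iff _ _).2 hd, owaUtil_singleton] at h
    exact le_of_mul_le_mul_left h hlam
  · intro h
    obtain ⟨d, hd⟩ := exists_isWinner (Function.update A i B')
    rw [(winners_eq_singleton_iff _ _).2 hd, owaUtil_singleton]
    exact mul_le_mul_of_nonneg_left (h d hd) hlam.le

/-- In a minimal best response a voter approves at most the winner. -/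
lemma MinimalBestResponse.subset_singleton [Fintype C] [Nonempty C] {lam : ℕ → ℝ}
    (hlam : 0 < lam 0) {v : C → ℝ} {A : N → Finset C} {i : N} {w : C} (hw : IsWinner A w)
    (h : MinimalBestResponse (fun _ n => (n : ℝ)) 1 lam v A i (A i)) : A i ⊆ {w} := by
  have hw' : IsWinner (Function.update A i (A i ∩ {w})) w := by
    intro d
    have h₁ := hw d
    rw [score_eq_add A i d, score_eq_add A i w] at h₁
    rw [score_update A i _ d, score_update A i _ w]
    by_cases hd : d = w
    · subst hd
      exact Or.inr ⟨rfl, le_rfl⟩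
    · simp only [mem_inter, mem_singleton, hd, and_false, and_true, if_false]
      grind
  have hbr : BestResponse (fun _ n => (n : ℝ)) 1 lam v A i (A i ∩ {w}) := by
    rw [bestResponse_iff hlam hw', ← bestResponse_iff hlam (B := A i)]
    · exact h.1
    · rwa [Function.update_eq_self]
  have := eq_of_subset_of_card_le inter_subset_left (h.2 _ hbr)
  rw [← this]
  exact inter_subset_right

/-- A voter who must approve the winner to have it elected, or who abstains, is playing a
minimal best response as soon as no deviation yields a better winner. -/
lemma minimalBestResponse_of_le [Fintype C] [Nonempty C] {lam : ℕ → ℝ} (hlam : 0 < lam 0)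
    {v : C → ℝ} (hv : Function.Injective v) {A : N → Finset C} {i : N} {w : C}
    (hw : IsWinner A w) (hle : ∀ B d, IsWinner (Function.update A i B) d → v d ≤ v w)
    (hA : A i = ∅ ∨ (A i = {w} ∧ ¬ IsWinner (Function.update A i ∅) w)) :
    MinimalBestResponse (fun _ n => (n : ℝ)) 1 lam v A i (A i) := by
  have hw' : IsWinner (Function.update A i (A i)) w := by rwa [Function.update_eq_self]
  refine ⟨(bestResponse_iff hlam hw').2 hle, fun B hB => ?_⟩
  rcases hA with hA | ⟨hA, hn⟩
  · simp [hA]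
  · rw [hA, card_singleton, Nat.one_le_iff_ne_zero, card_ne_zero]
    by_contra hne
    rw [not_nonempty_iff_eq_empty] at hne
    subst hne
    obtain ⟨d, hd⟩ := exists_isWinner (Function.update A i ∅)
    have hwd : v w ≤ v d := (bestResponse_iff hlam hd).1 hB _ _ hw'
    have : d = w := hv (le_antisymm (hle _ _ hd) hwd)
    exact hn (this ▸ hd)

lemma isWinner_update_singleton {A : N → Finset C} {i : N}
    (h : ∀ c, score (Function.update A i ∅) c = 0) (c : C) :
    IsWinner (Function.update A i {c}) c := by
  intro d
  rw [score_update, score_update A i _ c, h, h]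
  by_cases hd : d = c <;> simp [hd]

end SingleWinner

/-- for `k = 1`, `{cj}` is a lazy-PNE outcome iff either (i) `cj` is every
voter's most preferred candidate, or (ii) `cj` is not the highest-priority candidate, `cj` is
some voter's most preferred candidate, and every voter prefers `cj` to every candidate of
higher priority. -/
theorem statement_16 {N C : Type*} [Fintype N] [DecidableEq N] [Nonempty N]
    [Fintype C] [LinearOrder C]
    (u : N → C → ℝ) (hu : ∀ i, Function.Injective (u i))
    (lam : N → ℕ → ℝ) (hlam : ∀ i, 0 < lam i 0)
    (cj : C) :
    (∃ A : N → Finset C, LazyPNE (fun _ n => (n : ℝ)) 1 lam u A ∧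
        winners (fun _ n => (n : ℝ)) 1 A = {cj}) ↔
      ((∀ i : N, ∀ c : C, c ≠ cj → u i c < u i cj) ∨
        ((∃ c : C, c < cj) ∧ (∃ i : N, ∀ c : C, c ≠ cj → u i c < u i cj) ∧
          ∀ i : N, ∀ c : C, c < cj → u i c < u i cj)) := by
  have : Nonempty C := ⟨cj⟩
  simp only [winners_eq_singleton_iff]
  constructor
  · rintro ⟨A, hA, hw⟩
    have hsub : ∀ i, A i ⊆ {cj} := fun i => (hA i).subset_singleton (hlam i) hw
    have hself : ∀ i, IsWinner (Function.update A i (A i)) cj := fun i => by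
      rwa [Function.update_eq_self]
    have hlt : ∀ i B d, d ≠ cj → IsWinner (Function.update A i B) d → u i d < u i cj :=
      fun i B d hd h => lt_of_le_of_ne ((bestResponse_iff (hlam i) (hself i)).1 (hA i).1 B d h)
        fun he => hd (hu i he)
    have hzero : ∀ d, d ≠ cj → score A d = 0 := by
      intro d hd
      simp only [score, card_eq_zero, filter_eq_empty_iff]
      exact fun i _ hi => hd (mem_singleton.1 (hsub i hi))
    by_cases hall : ∀ i, A i = ∅
    · left
      intro i c hc
      refine hlt i {c} c hc (isWinner_update_singleton (fun d => ?_) c)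
      rw [← hall i, Function.update_eq_self]
      simp [score, hall]
    · right
      push Not at hall
      obtain ⟨i, hi⟩ := hall
      have hi' : A i = {cj} := (subset_singleton_iff.1 (hsub i)).resolve_left hi.ne_empty
      have hz : ∀ d, d ≠ cj → score (Function.update A i ∅) d = 0 := by
        intro d hd
        have h₁ := hzero d hd
        rw [score_eq_add A i d] at h₁
        omega
      have hn : ¬ IsWinner (Function.update A i ∅) cj := by
        intro h
        have hb : BestResponse (fun _ n => (n : ℝ)) 1 (lam i) (u i) A i ∅ :=
          (bestResponse_iff (hlam i) h).2 ((bestResponse_iff (hlam i) (hself i)).1 (hA i).1)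
        have := (hA i).2 _ hb
        simp [hi'] at this
      unfold IsWinner at hn
      push Not at hn
      obtain ⟨c', h₁, h₂⟩ := hn
      have hc' : c' ≠ cj := by
        rintro rfl
        exact absurd (h₂ rfl) (lt_irrefl _)
      rw [hz c' hc'] at h₁ h₂
      have hz' : ∀ d, score (Function.update A i ∅) d = 0 := by
        intro d
        by_cases hd : d = cj
        · subst hd
          omega
        · exact hz d hd
      refine ⟨⟨c', h₂ (by omega)⟩,
        ⟨i, fun c hc => hlt i {c} c hc (isWinner_update_singleton hz' c)⟩, fun k c hc => ?_⟩
      refine hlt k {c} c hc.ne fun d => ?_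
      have hone : score A cj = 1 := by
        rw [score_eq_add A i, hz', hi']
        simp
      have e₁ := score_eq_add A k d
      have e₂ := score_eq_add A k c
      have e₃ := hzero c hc.ne
      rw [score_update, score_update A k _ c]
      by_cases hdc : d = c
      · subst hdc
        exact Or.inr ⟨rfl, le_rfl⟩
      · simp only [mem_singleton, hdc, if_false, if_true]
        by_cases hd : d = cj
        · subst hd
          have := hc.le
          grind
        · have := hzero d hd
          omega
  · intro h
    have hcase : ((∀ i c, c ≠ cj → u i c < u i cj) ∧ ∀ c, cj ≤ c) ∨
        ((∃ c : C, c < cj) ∧ (∃ i : N, ∀ c : C, c ≠ cj → u i c < u i cj) ∧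
          ∀ i : N, ∀ c : C, c < cj → u i c < u i cj) := by
      rcases h with h | h
      · by_cases hm : ∃ c, c < cj
        · exact Or.inr ⟨hm, ⟨Classical.arbitrary N, h _⟩, fun i c hc => h i c hc.ne⟩
        · exact Or.inl ⟨h, fun c => not_lt.1 fun hc => hm ⟨c, hc⟩⟩
      · exact Or.inr h
    have hle : ∀ i, (∀ c, c ≠ cj → u i c < u i cj) → ∀ c, u i c ≤ u i cj := by
      intro i hi c
      by_cases hc : c = cj
      · rw [hc]
      · exact (hi c hc).le
    rcases hcase with ⟨htop, hmin⟩ | ⟨⟨c₀, hc₀⟩, ⟨i₀, hi₀⟩, hpri⟩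
    · have hw : IsWinner (fun _ : N => (∅ : Finset C)) cj :=
        fun d => Or.inr ⟨by simp [score], hmin d⟩
      exact ⟨fun _ => ∅, fun i => minimalBestResponse_of_le (hlam i) (hu i) hw
        (fun _ d _ => hle i (htop i) d) (Or.inl rfl), hw⟩
    · set A : N → Finset C := Function.update (fun _ => ∅) i₀ {cj} with hAdef
      have h₀ : Function.update A i₀ ∅ = fun _ => ∅ := by
        rw [hAdef, Function.update_idem, Function.update_eq_self_iff]
      have hz : ∀ d, score (Function.update A i₀ ∅) d = 0 := by
        intro d
        simp [h₀, score]
      have hi₀A : A i₀ = {cj} := by simp [hAdef]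
      have hw : IsWinner A cj := by
        rw [← Function.update_eq_self i₀ A, hi₀A]
        exact isWinner_update_singleton hz cj
      refine ⟨A, fun i => ?_, hw⟩
      by_cases hi : i = i₀
      · subst hi
        refine minimalBestResponse_of_le (hlam i) (hu i) hw (fun _ d _ => hle i hi₀ d)
          (Or.inr ⟨hi₀A, fun hn => ?_⟩)
        rcases hn c₀ with hlt | ⟨-, hge⟩
        · rw [hz, hz] at hlt
          exact lt_irrefl _ hlt
        · exact absurd hc₀ (not_lt.2 hge)
      · have hiA : A i = ∅ := by simp [hAdef, hi]
        refine minimalBestResponse_of_le (hlam i) (hu i) hw (fun B d hd => ?_) (Or.inl hiA)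
        by_cases hdc : d = cj
        · rw [hdc]
        · refine (hpri i d (lt_of_not_ge fun hge => ?_)).le
          have hsc : ∀ c, score (Function.update A i ∅) c = if c = cj then 1 else 0 := by
            intro c
            rw [← hiA, Function.update_eq_self, score_eq_add A i₀, hz, hi₀A]
            simp
          have h₁ := hd cj
          rw [score_update, score_update A i B d, hsc, hsc, if_pos rfl, if_neg hdc] at h₁
          have : ¬ d ≤ cj := fun h' => hdc (le_antisymm h' hge)
          grind
end
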